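/- The average of the filled monomial m² is asymptotically independent of the cavity perturbation parameter t in β-average: for every α > 0, every t ∈ [0,1] and every 0 < β₁ < β₂, lim_{N→∞} ∫_{β₁}^{β₂} ( ⟨m²⟩_{N,t}(β) − ⟨m²⟩_N(β) ) dβ = 0, where m = (1/N)∑_{i=1}^N σ_i. -/

import Mathlib

open scoped BigOperators

noncomputable section

/-- The Poisson probability mass function with mean `lam`. -/
def pois (lam : ℝ) (k : ℕ) : ℝ := Real.exp (-lam) * lam ^ k / (Nat.factorial k)

/-- The spin value (±1) attached to a Boolean opinion. -/
def spin (b : Bool) : ℝ := if b then 1 else -1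

/-- Average of `f` over `p` families of `k` i.i.d. indices, each uniform on `Fin N`. -/
def avgIdx (N : ℕ) (p k : ℕ) (f : (Fin p → Fin k → Fin N) → ℝ) : ℝ :=
  ((N : ℝ) ^ (p * k))⁻¹ * ∑ im : Fin p → Fin k → Fin N, f im

/-- The interaction sum `∑_{ν=1}^k σ_{i_ν^1} ⋯ σ_{i_ν^p}`; the Hamiltonian is its negative. -/
def intSum {N p k : ℕ} (im : Fin p → Fin k → Fin N) (σ : Fin N → Bool) : ℝ :=
  ∑ ν : Fin k, ∏ l : Fin p, spin (σ (im l ν))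

/-- The diluted `p`-spin Hamiltonian `H = -∑_{ν=1}^k σ_{i_ν^1} ⋯ σ_{i_ν^p}`. -/
def Hspin {N p k : ℕ} (im : Fin p → Fin k → Fin N) (σ : Fin N → Bool) : ℝ :=
  - intSum im σ

/-- Partition function `Z = ∑_σ e^{-β H(σ)}`. -/
def Zpart (β : ℝ) {N p k : ℕ} (im : Fin p → Fin k → Fin N) : ℝ :=
  ∑ σ : Fin N → Bool, Real.exp (β * intSum im σ)

/-- Cavity term `∑_{ν=1}^{k'} σ_{i_ν^1} ⋯ σ_{i_ν^q}` (with `q = p - 1` families). -/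
def cavSum {N q k' : ℕ} (im' : Fin q → Fin k' → Fin N) (σ : Fin N → Bool) : ℝ :=
  ∑ ν : Fin k', ∏ l : Fin q, spin (σ (im' l ν))

/-- Perturbed Boltzmann weight `exp(β(∑_ν σ_{i_ν^1}⋯σ_{i_ν^p} + ∑_ν σ_{i'_ν^1}⋯σ_{i'_ν^{q}}))`. -/
def wpert (β : ℝ) {N p k q k' : ℕ} (im : Fin p → Fin k → Fin N)
    (im' : Fin q → Fin k' → Fin N) (σ : Fin N → Bool) : ℝ :=
  Real.exp (β * (intSum im σ + cavSum im' σ))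

/-- Perturbed partition function. -/
def Zpert (β : ℝ) {N p k q k' : ℕ} (im : Fin p → Fin k → Fin N)
    (im' : Fin q → Fin k' → Fin N) : ℝ :=
  ∑ σ : Fin N → Bool, wpert β im im' σ

/-- Replicated (unperturbed) Boltzmann state `Ω(g)` on `s` replicas sharing the same disorder. -/
def OmegaB (β : ℝ) {N p k : ℕ} (im : Fin p → Fin k → Fin N)
    (s : ℕ) (g : (Fin s → Fin N → Bool) → ℝ) : ℝ :=
  (∑ σs : Fin s → Fin N → Bool, g σs * ∏ a : Fin s, Real.exp (β * intSum im (σs a))) /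
    (Zpart β im) ^ s

/-- Replicated perturbed Boltzmann state `Ω̃_t(g)` on `s` replicas sharing the same disorder. -/
def OmegaPert (β : ℝ) {N p k q k' : ℕ} (im : Fin p → Fin k → Fin N)
    (im' : Fin q → Fin k' → Fin N) (s : ℕ) (g : (Fin s → Fin N → Bool) → ℝ) : ℝ :=
  (∑ σs : Fin s → Fin N → Bool, g σs * ∏ a : Fin s, wpert β im im' (σs a)) /
    (Zpert β im im') ^ s

/-- Quenched expectation: the number of interaction terms is Poisson of mean `γ N` and the
`p` index families are i.i.d. uniform on `Fin N`. -/
def Equench (N p : ℕ) (γ : ℝ) (f : (k : ℕ) → (Fin p → Fin k → Fin N) → ℝ) : ℝ :=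
  ∑' k : ℕ, pois (γ * N) k * avgIdx N p k (fun im => f k im)

/-- Quenched expectation including the cavity randomness: the cavity term has a Poisson
number of terms of mean `2 γ t`, with `p - 1` independent uniform index families. -/
def EquenchCav (N p : ℕ) (γ t : ℝ)
    (f : (k : ℕ) → (Fin p → Fin k → Fin N) →
         (k' : ℕ) → (Fin (p - 1) → Fin k' → Fin N) → ℝ) : ℝ :=
  ∑' k : ℕ, pois (γ * N) k * avgIdx N p k (fun im =>
    ∑' k' : ℕ, pois (2 * γ * t) k' * avgIdx N (p - 1) k' (fun im' => f k im k' im'))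

/-- Quenched average of `ln Z_N`. -/
def ElnZ (N p : ℕ) (γ β : ℝ) : ℝ :=
  Equench N p γ (fun _ im => Real.log (Zpart β im))

/-- Quenched pressure `A_N = (1/N) E[ln Z_N]`. -/
def pressure (N p : ℕ) (γ β : ℝ) : ℝ :=
  (N : ℝ)⁻¹ * ElnZ N p γ β

/-- Cavity function `Ψ_N(t) = E[ln (Z_{N,t} / Z_N)]`. -/
def cavityFn (N p : ℕ) (γ β t : ℝ) : ℝ :=
  EquenchCav N p γ t (fun _ im _ im' => Real.log (Zpert β im im' / Zpart β im))

/-- The multi-overlap `q_{1…n} = (1/N) ∑_i σ_i^{(1)} ⋯ σ_i^{(n)}` of `n` replicas. -/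
def qOv (N n : ℕ) (σs : Fin n → Fin N → Bool) : ℝ :=
  (N : ℝ)⁻¹ * ∑ x : Fin N, ∏ a : Fin n, spin (σs a x)

/-- Total (quenched) average `⟨q_{1…n}^r⟩_N` of the `r`-th power of the `n`-replica overlap. -/
def qPowAvg (N p : ℕ) (γ β : ℝ) (n r : ℕ) : ℝ :=
  Equench N p γ (fun _ im => OmegaB β im n (fun σs => (qOv N n σs) ^ r))

/-- Perturbed total average `⟨q_{1…n}^r⟩_{N,t}` of the `r`-th power of the `n`-replica overlap. -/
def qPowAvgPert (N p : ℕ) (γ β t : ℝ) (n r : ℕ) : ℝ :=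
  EquenchCav N p γ t (fun _ im _ im' => OmegaPert β im im' n (fun σs => (qOv N n σs) ^ r))

end

open Filter

section FiniteGibbs

variable {S : Type*} [Fintype S]

/-- Average of `g` with respect to the normalized weight `w` on a finite space. -/
noncomputable def gibbsAvg (w g : S → ℝ) : ℝ := (∑ x, g x * w x) / ∑ x, w x

/-- Covariance of `f` and `g` under the weight `w`, multiplied by the squared total mass. -/
noncomputable def unnormCov (w f g : S → ℝ) : ℝ :=
  (∑ x, f x * g x * w x) * (∑ x, w x) - (∑ x, f x * w x) * (∑ x, g x * w x)

theorem unnormCov_sum_right {ι : Type*} (s : Finset ι) (w f : S → ℝ) (g : ι → S → ℝ) :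
    unnormCov w f (fun x => ∑ i ∈ s, g i x) = ∑ i ∈ s, unnormCov w f (g i) := by
  simp only [unnormCov, Finset.sum_sub_distrib, ← Finset.sum_mul, ← Finset.mul_sum]
  congr 2
  · rw [Finset.sum_comm]
    refine Finset.sum_congr rfl fun x _ => ?_
    rw [Finset.mul_sum, Finset.sum_mul]
  · rw [Finset.sum_comm]
    exact Finset.sum_congr rfl fun x _ => by rw [Finset.sum_mul]

theorem unnormCov_comm (w f g : S → ℝ) : unnormCov w f g = unnormCov w g f := by
  simp only [unnormCov, mul_comm (f _) (g _)]
  ring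

theorem unnormCov_const_mul_right (c : ℝ) (w f g : S → ℝ) :
    unnormCov w f (fun x => c * g x) = c * unnormCov w f g := by
  have h1 : ∑ x, f x * (c * g x) * w x = c * ∑ x, f x * g x * w x := by
    rw [Finset.mul_sum]; exact Finset.sum_congr rfl fun x _ => by ring
  have h2 : ∑ x, c * g x * w x = c * ∑ x, g x * w x := by
    rw [Finset.mul_sum]; exact Finset.sum_congr rfl fun x _ => by ring
  rw [unnormCov, unnormCov, h1, h2]
  ring

theorem exp_mul_of_sq_eq_one {s : ℝ} (hs : s ^ 2 = 1) (b : ℝ) :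
    Real.exp (b * s) = Real.cosh b + Real.sinh b * s := by
  rcases mul_self_eq_one_iff.mp ((sq s).symm.trans hs) with rfl | rfl
  · simp [Real.cosh_add_sinh]
  · simp [← sub_eq_add_neg, Real.cosh_sub_sinh]

/-- Tilting by an exponential of a `±1`-valued observable `s` does not change the unnormalized
covariance with `s`. -/
theorem unnormCov_tilt (w f s : S → ℝ) (hs : ∀ x, s x ^ 2 = 1) (b : ℝ) :
    unnormCov (fun x => Real.exp (b * s x) * w x) f s = unnormCov w f s := by
  set c := Real.cosh b
  set d := Real.sinh b
  have hcd : c ^ 2 - d ^ 2 = 1 := Real.cosh_sq_sub_sinh_sq b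
  have e1 : ∀ g : S → ℝ, ∑ x, g x * (Real.exp (b * s x) * w x)
      = c * (∑ x, g x * w x) + d * ∑ x, g x * s x * w x := by
    intro g
    rw [Finset.mul_sum, Finset.mul_sum, ← Finset.sum_add_distrib]
    refine Finset.sum_congr rfl fun x _ => ?_
    rw [exp_mul_of_sq_eq_one (hs x)]
    ring
  have e2 : ∀ g : S → ℝ, ∑ x, g x * s x * s x * w x = ∑ x, g x * w x := fun g =>
    Finset.sum_congr rfl fun x _ => by
      have := hs x
      linear_combination g x * w x * this
  have h1 := e1 (fun _ => 1)
  have h2 := e2 (fun _ => 1)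
  simp only [one_mul] at h1 h2
  rw [unnormCov, unnormCov, e1 (fun x => f x * s x), e1 f, h1, e1 s, e2 f, h2]
  linear_combination
    ((∑ x, f x * s x * w x) * (∑ x, w x) - (∑ x, f x * w x) * (∑ x, s x * w x)) * hcd

theorem gibbsAvg_add (w f g : S → ℝ) :
    gibbsAvg w (fun x => f x + g x) = gibbsAvg w f + gibbsAvg w g := by
  simp only [gibbsAvg, add_mul, Finset.sum_add_distrib, add_div]

theorem gibbsAvg_const_mul (w g : S → ℝ) (c : ℝ) :
    gibbsAvg w (fun x => c * g x) = c * gibbsAvg w g := by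
  simp only [gibbsAvg, mul_assoc, ← Finset.mul_sum, mul_div_assoc]

variable [Nonempty S]

theorem total_pos {w : S → ℝ} (hw : ∀ x, 0 < w x) : 0 < ∑ x, w x :=
  Finset.sum_pos (fun x _ => hw x) Finset.univ_nonempty

theorem gibbsAvg_mono {w f g : S → ℝ} (hw : ∀ x, 0 < w x) (h : ∀ x, f x ≤ g x) :
    gibbsAvg w f ≤ gibbsAvg w g :=
  div_le_div_of_nonneg_right
    (Finset.sum_le_sum fun x _ => mul_le_mul_of_nonneg_right (h x) (hw x).le) (total_pos hw).le

theorem gibbsAvg_const {w : S → ℝ} (hw : ∀ x, 0 < w x) (c : ℝ) :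
    gibbsAvg w (fun _ => c) = c := by
  rw [gibbsAvg, ← Finset.mul_sum, mul_div_cancel_right₀ _ (total_pos hw).ne']

theorem gibbsAvg_mem_Icc {w f : S → ℝ} (hw : ∀ x, 0 < w x) (hf : ∀ x, f x ∈ Set.Icc (0 : ℝ) 1) :
    gibbsAvg w f ∈ Set.Icc (0 : ℝ) 1 :=
  ⟨(gibbsAvg_const hw 0).symm.le.trans (gibbsAvg_mono hw fun x => (hf x).1),
    (gibbsAvg_mono hw fun x => (hf x).2).trans (gibbsAvg_const hw 1).le⟩

theorem abs_gibbsAvg_sub_le {w f : S → ℝ} (hw : ∀ x, 0 < w x) (a : ℝ) :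
    |gibbsAvg w f - a| ≤ gibbsAvg w (fun x => |f x - a|) := by
  have h : gibbsAvg w f - a = gibbsAvg w (fun x => f x + -a) := by
    rw [gibbsAvg_add, gibbsAvg_const hw, sub_eq_add_neg]
  rw [h, gibbsAvg, gibbsAvg, abs_div, abs_of_pos (total_pos hw)]
  refine div_le_div_of_nonneg_right ((Finset.abs_sum_le_sum_abs _ _).trans_eq ?_) (total_pos hw).le
  exact Finset.sum_congr rfl fun x _ => by rw [abs_mul, abs_of_pos (hw x), sub_eq_add_neg]

theorem unnormCov_self_div {w : S → ℝ} (hw : ∀ x, 0 < w x) (f : S → ℝ) :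
    unnormCov w f f / (∑ x, w x) ^ 2 = gibbsAvg w (fun x => (f x - gibbsAvg w f) ^ 2) := by
  have hZ := (total_pos hw).ne'
  have h : ∀ a, ∑ x, (f x - a) ^ 2 * w x
      = (∑ x, f x * f x * w x) - 2 * a * (∑ x, f x * w x) + a ^ 2 * ∑ x, w x := by
    intro a
    rw [Finset.mul_sum, Finset.mul_sum, ← Finset.sum_sub_distrib, ← Finset.sum_add_distrib]
    exact Finset.sum_congr rfl fun x _ => by ring
  simp only [gibbsAvg]
  rw [h, unnormCov]
  field_simp
  ring

theorem unnormCov_self_div_mem_Icc {w f : S → ℝ} (hw : ∀ x, 0 < w x)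
    (hf : ∀ x, f x ∈ Set.Icc (0 : ℝ) 1) :
    unnormCov w f f / (∑ x, w x) ^ 2 ∈ Set.Icc (0 : ℝ) 1 := by
  rw [unnormCov_self_div hw]
  obtain ⟨h0, h1⟩ := gibbsAvg_mem_Icc hw hf
  refine gibbsAvg_mem_Icc hw fun x => ⟨sq_nonneg _, ?_⟩
  obtain ⟨h2, h3⟩ := hf x
  rw [sq_le_one_iff_abs_le_one, abs_le]
  constructor <;> linarith

/-- A bounded tilt `exp (b * c)`, `|c| ≤ K`, moves averages by at most `exp (2 b K)` times the
mean absolute deviation, itself bounded through the variance. -/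
theorem abs_gibbsAvg_tilt_sub_le {w f c : S → ℝ} (hw : ∀ x, 0 < w x) {b K ε : ℝ} (hb : 0 ≤ b)
    (hc : ∀ x, |c x| ≤ K) (hε : 0 < ε) :
    |gibbsAvg (fun x => Real.exp (b * c x) * w x) f - gibbsAvg w f| ≤
      Real.exp (2 * b * K) * (ε + ε⁻¹ * (unnormCov w f f / (∑ x, w x) ^ 2)) := by
  have hw' : ∀ x, 0 < Real.exp (b * c x) * w x := fun x => mul_pos (Real.exp_pos _) (hw x)
  set a := gibbsAvg w f with ha
  have key : ∀ g : S → ℝ, (∀ x, 0 ≤ g x) →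
      gibbsAvg (fun x => Real.exp (b * c x) * w x) g ≤ Real.exp (2 * b * K) * gibbsAvg w g := by
    intro g hg
    have hN : ∑ x, g x * (Real.exp (b * c x) * w x) ≤ Real.exp (b * K) * ∑ x, g x * w x := by
      rw [Finset.mul_sum]
      refine Finset.sum_le_sum fun x _ => ?_
      have : Real.exp (b * c x) ≤ Real.exp (b * K) :=
        Real.exp_le_exp.2 (mul_le_mul_of_nonneg_left (abs_le.1 (hc x)).2 hb)
      have h2 := mul_le_mul_of_nonneg_right this (mul_nonneg (hg x) (hw x).le)
      linarith
    have hD : Real.exp (-(b * K)) * ∑ x, w x ≤ ∑ x, Real.exp (b * c x) * w x := by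
      rw [Finset.mul_sum]
      refine Finset.sum_le_sum fun x _ => mul_le_mul_of_nonneg_right ?_ (hw x).le
      rw [Real.exp_le_exp, ← mul_neg]
      exact mul_le_mul_of_nonneg_left (abs_le.1 (hc x)).1 hb
    have hZ := total_pos hw
    have hS : 0 ≤ ∑ x, g x * w x := Finset.sum_nonneg fun x _ => mul_nonneg (hg x) (hw x).le
    rw [gibbsAvg, gibbsAvg]
    calc _ ≤ (Real.exp (b * K) * ∑ x, g x * w x) / (Real.exp (-(b * K)) * ∑ x, w x) :=
          div_le_div₀ (by positivity) hN (by positivity) hD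
      _ = _ := by
          rw [mul_div_mul_comm, ← Real.exp_sub]
          congr 2
          ring
  refine (abs_gibbsAvg_sub_le hw' a).trans ((key _ fun x => abs_nonneg _).trans ?_)
  refine mul_le_mul_of_nonneg_left ?_ (Real.exp_pos _).le
  rw [unnormCov_self_div hw, ← ha]
  calc _ ≤ gibbsAvg w (fun x => ε + ε⁻¹ * (f x - a) ^ 2) := by
        refine gibbsAvg_mono hw fun x => ?_
        rw [← sq_abs (f x - a)]
        set y := |f x - a|
        have : 0 ≤ ε⁻¹ * ((y - ε / 2) ^ 2 + 3 / 4 * ε ^ 2) := by positivity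
        have h2 : ε⁻¹ * ε = 1 := inv_mul_cancel₀ hε.ne'
        have h3 : ε⁻¹ * ((y - ε / 2) ^ 2 + 3 / 4 * ε ^ 2) = ε⁻¹ * y ^ 2 - y + ε := by
          linear_combination (-y + ε) * h2
        linarith
    _ = _ := by rw [gibbsAvg_add, gibbsAvg_const hw, gibbsAvg_const_mul]

theorem hasDerivAt_gibbsAvg (f h : S → ℝ) (b : ℝ) :
    HasDerivAt (fun b => gibbsAvg (fun x => Real.exp (b * h x)) f)
      (unnormCov (fun x => Real.exp (b * h x)) f h / (∑ x, Real.exp (b * h x)) ^ 2) b := by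
  have hZ := (total_pos (w := fun x : S => Real.exp (b * h x)) fun x => Real.exp_pos _).ne'
  have h0 : ∀ x, HasDerivAt (fun b => Real.exp (b * h x)) (Real.exp (b * h x) * h x) b := fun x => by
    simpa using ((hasDerivAt_id b).mul_const (h x)).exp
  have h1 : HasDerivAt (fun b => ∑ x, f x * Real.exp (b * h x))
      (∑ x, f x * (Real.exp (b * h x) * h x)) b :=
    HasDerivAt.fun_sum fun x _ => (h0 x).const_mul (f x)
  have h2 : HasDerivAt (fun b => ∑ x, Real.exp (b * h x)) (∑ x, Real.exp (b * h x) * h x) b :=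
    HasDerivAt.fun_sum fun x _ => h0 x
  refine (h1.fun_div h2 hZ).congr_deriv ?_
  rw [unnormCov]
  congr 3
  · exact Finset.sum_congr rfl fun x _ => by ring
  · exact Finset.sum_congr rfl fun x _ => by ring

theorem continuous_unnormCov_exp_div (f g h : S → ℝ) :
    Continuous fun b : ℝ => unnormCov (fun x => Real.exp (b * h x)) f g /
      (∑ x, Real.exp (b * h x)) ^ 2 := by
  unfold unnormCov
  refine Continuous.div (by fun_prop) (by fun_prop) fun b => ?_
  exact pow_ne_zero _ (total_pos fun x => Real.exp_pos _).ne'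

end FiniteGibbs

section Griffiths

variable {N p : ℕ}

/-- The spin monomial `σ_{e 1} ⋯ σ_{e p}`. -/
noncomputable def spinProd (e : Fin p → Fin N) (σ : Fin N → Bool) : ℝ := ∏ l, spin (σ (e l))

theorem spin_sq (b : Bool) : spin b ^ 2 = 1 := by cases b <;> simp [spin]

theorem abs_spin (b : Bool) : |spin b| = 1 := by cases b <;> simp [spin]

theorem spin_beq (a b : Bool) : spin (a == b) = spin a * spin b := by
  cases a <;> cases b <;> simp [spin]

theorem spinProd_sq (e : Fin p → Fin N) (σ : Fin N → Bool) : spinProd e σ ^ 2 = 1 := by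
  simp [spinProd, ← Finset.prod_pow, spin_sq]

theorem abs_spinProd (e : Fin p → Fin N) (σ : Fin N → Bool) : |spinProd e σ| = 1 := by
  simp [spinProd, Finset.abs_prod, abs_spin]

theorem spinProd_le_one (e : Fin p → Fin N) (σ : Fin N → Bool) : spinProd e σ ≤ 1 :=
  (le_abs_self _).trans (abs_spinProd e σ).le

theorem spinProd_beq (e : Fin p → Fin N) (σ ρ : Fin N → Bool) :
    spinProd e (fun i => σ i == ρ i) = spinProd e σ * spinProd e ρ := by
  simp [spinProd, spin_beq, Finset.prod_mul_distrib]

/-- All correlations of spin monomials against the weight `g` are nonnegative. -/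
def PosCorr (g : (Fin N → Bool) → ℝ) : Prop :=
  ∀ c : Fin N → ℕ, 0 ≤ ∑ σ, g σ * ∏ i, spin (σ i) ^ c i

theorem posCorr_one : PosCorr (fun _ : Fin N → Bool => (1 : ℝ)) := by
  intro c
  simp only [one_mul]
  rw [← Fintype.prod_sum (fun i (b : Bool) => spin b ^ c i)]
  refine Finset.prod_nonneg fun i _ => ?_
  rcases neg_one_pow_eq_or ℝ (c i) with h | h <;> simp [spin, h]

theorem PosCorr.affine_mul {g : (Fin N → Bool) → ℝ} (hg : PosCorr g) {a b : ℝ} (ha : 0 ≤ a)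
    (hb : 0 ≤ b) (e : Fin p → Fin N) : PosCorr (fun σ => (a + b * spinProd e σ) * g σ) := by
  intro c
  have h : ∀ σ : Fin N → Bool, spinProd e σ * ∏ i, spin (σ i) ^ c i
      = ∏ i, spin (σ i) ^ (c i + (Finset.univ.filter fun l => e l = i).card) := by
    intro σ
    simp only [pow_add, Finset.prod_mul_distrib]
    rw [mul_comm, spinProd, ← Finset.prod_fiberwise Finset.univ e]
    congr 1
    refine Finset.prod_congr rfl fun i _ => ?_
    rw [← Finset.prod_const]
    exact Finset.prod_congr rfl fun l hl => by rw [(Finset.mem_filter.1 hl).2]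
  have h2 : ∑ σ, (a + b * spinProd e σ) * g σ * ∏ i, spin (σ i) ^ c i
      = a * (∑ σ, g σ * ∏ i, spin (σ i) ^ c i) + b * ∑ σ, g σ *
        ∏ i, spin (σ i) ^ (c i + (Finset.univ.filter fun l => e l = i).card) := by
    rw [Finset.mul_sum, Finset.mul_sum, ← Finset.sum_add_distrib]
    refine Finset.sum_congr rfl fun σ _ => ?_
    rw [← h]
    ring
  rw [h2]
  exact add_nonneg (mul_nonneg ha (hg _)) (mul_nonneg hb (hg _))

theorem posCorr_exp {ι : Type*} (s : Finset ι) (J : ι → ℝ) (hJ : ∀ i, 0 ≤ J i)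
    (e : ι → Fin p → Fin N) : PosCorr (fun σ => Real.exp (∑ i ∈ s, J i * spinProd (e i) σ)) := by
  classical
  induction s using Finset.induction_on with
  | empty => simpa using posCorr_one
  | insert i s hi ih =>
    have := ih.affine_mul (Real.cosh_pos (J i)).le (Real.sinh_nonneg_iff.2 (hJ i)) (e i)
    simpa only [Finset.sum_insert hi, Real.exp_add, exp_mul_of_sq_eq_one (spinProd_sq (e i) _)]
      using this

/-- First Griffiths inequality for a product of two spin monomials. -/
theorem griffiths_first {ι : Type*} [Fintype ι] {r r' : ℕ} (J : ι → ℝ) (hJ : ∀ i, 0 ≤ J i)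
    (e : ι → Fin p → Fin N) (a : Fin r → Fin N) (b : Fin r' → Fin N) :
    0 ≤ ∑ σ, spinProd a σ * spinProd b σ * Real.exp (∑ i, J i * spinProd (e i) σ) := by
  have := (((posCorr_exp Finset.univ J hJ e).affine_mul le_rfl zero_le_one b).affine_mul
    le_rfl zero_le_one a) 0
  simpa [mul_assoc] using this

/-- Second Griffiths inequality. -/
theorem griffiths_second {ι : Type*} [Fintype ι] {r r' : ℕ} {β : ℝ} (hβ : 0 ≤ β)
    (e : ι → Fin p → Fin N) (a : Fin r → Fin N) (b : Fin r' → Fin N) :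
    0 ≤ unnormCov (fun σ => Real.exp (β * ∑ i, spinProd (e i) σ)) (spinProd a) (spinProd b) := by
  set w : (Fin N → Bool) → ℝ := fun σ => Real.exp (β * ∑ i, spinProd (e i) σ) with hw
  have hinv : ∀ σ : Fin N → Bool,
      Function.Involutive fun (ρ : Fin N → Bool) => fun i => σ i == ρ i := by
    intro σ ρ
    funext i
    cases h : σ i <;> cases h' : ρ i <;> simp [h, h']
  have h1 : unnormCov w (spinProd a) (spinProd b) = ∑ σ, ∑ τ,
      spinProd a σ * (spinProd b σ - spinProd b τ) * (w σ * w τ) := by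
    simp only [unnormCov, Finset.sum_mul_sum, ← Finset.sum_sub_distrib]
    exact Finset.sum_congr rfl fun σ _ => Finset.sum_congr rfl fun τ _ => by ring
  have h2 : ∀ σ ρ : Fin N → Bool, w σ * w (fun i => σ i == ρ i)
      = Real.exp (∑ i, β * (1 + spinProd (e i) ρ) * spinProd (e i) σ) := by
    intro σ ρ
    rw [hw, ← Real.exp_add, ← mul_add, ← Finset.sum_add_distrib, Finset.mul_sum]
    congr 1
    exact Finset.sum_congr rfl fun i _ => by rw [spinProd_beq]; ring
  have h3 : unnormCov w (spinProd a) (spinProd b) = ∑ ρ, (1 - spinProd b ρ) * ∑ σ,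
      spinProd a σ * spinProd b σ *
        Real.exp (∑ i, β * (1 + spinProd (e i) ρ) * spinProd (e i) σ) := by
    simp only [h1, Finset.mul_sum]
    conv_rhs => rw [Finset.sum_comm]
    refine Finset.sum_congr rfl fun σ _ => ?_
    rw [← Equiv.sum_comp (hinv σ).toPerm]
    refine Finset.sum_congr rfl fun ρ _ => ?_
    rw [Function.Involutive.coe_toPerm, h2, spinProd_beq]
    ring
  rw [h3]
  refine Finset.sum_nonneg fun ρ _ => mul_nonneg (sub_nonneg.2 (spinProd_le_one b ρ)) ?_
  refine griffiths_first _ (fun i => mul_nonneg hβ ?_) e a b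
  have := (abs_le.1 (abs_spinProd (e i) ρ).le).1
  linarith

end Griffiths

section DilutedModel

variable {N : ℕ}

/-- The squared magnetization. -/
noncomputable def magSq (N : ℕ) (σ : Fin N → Bool) : ℝ := ((N : ℝ)⁻¹ * ∑ x, spin (σ x)) ^ 2

/-- Boltzmann variance of the squared magnetization for fixed disorder. -/
noncomputable def magSqVar (b : ℝ) {k : ℕ} (im : Fin 2 → Fin k → Fin N) : ℝ :=
  unnormCov (fun σ => Real.exp (b * intSum im σ)) (magSq N) (magSq N) / Zpart b im ^ 2

/-- Average over the edges of the Boltzmann variance of the squared magnetization, for a fixed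
number `k` of edges. -/
noncomputable def avgMagSqVar (N k : ℕ) (b : ℝ) : ℝ := avgIdx N 2 k fun im => magSqVar b im

theorem magSq_eq (σ : Fin N → Bool) :
    magSq N σ = ((N : ℝ) ^ 2)⁻¹ * ∑ e : Fin 2 → Fin N, spinProd e σ := by
  rw [magSq, mul_pow, inv_pow, Fintype.sum_pow]
  rfl

theorem magSq_mem_Icc (σ : Fin N → Bool) : magSq N σ ∈ Set.Icc (0 : ℝ) 1 := by
  refine ⟨sq_nonneg _, ?_⟩
  rw [magSq, sq_le_one_iff_abs_le_one, abs_mul, abs_inv, Nat.abs_cast]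
  have h : |∑ x, spin (σ x)| ≤ N := by
    refine (Finset.abs_sum_le_sum_abs _ _).trans ?_
    simp [abs_spin]
  exact (mul_le_mul_of_nonneg_left h (by positivity)).trans (inv_mul_le_one)

theorem OmegaB_eq_gibbsAvg (b : ℝ) {k : ℕ} (im : Fin 2 → Fin k → Fin N) :
    OmegaB b im 1 (fun σs => qOv N 1 σs ^ 2) =
      gibbsAvg (fun σ => Real.exp (b * intSum im σ)) (magSq N) := by
  rw [OmegaB, gibbsAvg, pow_one, ← (Equiv.funUnique (Fin 1) (Fin N → Bool)).sum_comp]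
  simp [qOv, magSq, Zpart]

theorem OmegaPert_eq_gibbsAvg (b : ℝ) {k q k' : ℕ} (im : Fin 2 → Fin k → Fin N)
    (im' : Fin q → Fin k' → Fin N) :
    OmegaPert b im im' 1 (fun σs => qOv N 1 σs ^ 2) =
      gibbsAvg (fun σ => Real.exp (b * cavSum im' σ) * Real.exp (b * intSum im σ)) (magSq N) := by
  rw [OmegaPert, gibbsAvg, pow_one, ← (Equiv.funUnique (Fin 1) (Fin N → Bool)).sum_comp]
  simp [qOv, magSq, Zpert, wpert, mul_add, ← Real.exp_add, add_comm]

theorem abs_cavSum_le {q k' : ℕ} (im' : Fin q → Fin k' → Fin N) (σ : Fin N → Bool) :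
    |cavSum im' σ| ≤ k' := by
  refine (Finset.abs_sum_le_sum_abs _ _).trans ?_
  simp [Finset.abs_prod, abs_spin]

theorem magSqVar_mem_Icc (b : ℝ) {k : ℕ} (im : Fin 2 → Fin k → Fin N) :
    magSqVar b im ∈ Set.Icc (0 : ℝ) 1 :=
  unnormCov_self_div_mem_Icc (fun _ => Real.exp_pos _) magSq_mem_Icc

theorem abs_OmegaPert_sub_OmegaB_le {b ε : ℝ} (hb : 0 ≤ b) (hε : 0 < ε) {k q k' : ℕ}
    (im : Fin 2 → Fin k → Fin N) (im' : Fin q → Fin k' → Fin N) :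
    |OmegaPert b im im' 1 (fun σs => qOv N 1 σs ^ 2) - OmegaB b im 1 (fun σs => qOv N 1 σs ^ 2)| ≤
      Real.exp (2 * b * k') * (ε + ε⁻¹ * magSqVar b im) := by
  rw [OmegaPert_eq_gibbsAvg, OmegaB_eq_gibbsAvg]
  exact abs_gibbsAvg_tilt_sub_le (fun _ => Real.exp_pos _) hb (abs_cavSum_le im') hε

/-- Splitting off the `ν`-th edge from a family of `k + 1` edges. -/
def insertEdgeEquiv (N : ℕ) {k : ℕ} (ν : Fin (k + 1)) :
    (Fin 2 → Fin N) × (Fin 2 → Fin k → Fin N) ≃ (Fin 2 → Fin (k + 1) → Fin N) :=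
  (Equiv.arrowProdEquivProdArrow (Fin 2) (fun _ => Fin N) (fun _ => Fin k → Fin N)).symm.trans
    (Equiv.piCongrRight fun _ => Fin.insertNthEquiv (fun _ => Fin N) ν)

theorem insertEdgeEquiv_apply {k : ℕ} (ν : Fin (k + 1)) (e : Fin 2 → Fin N)
    (r : Fin 2 → Fin k → Fin N) (l : Fin 2) :
    insertEdgeEquiv N ν (e, r) l = ν.insertNth (α := fun _ => Fin N) (e l) (r l) := rfl

theorem intSum_insertEdge {k : ℕ} (ν : Fin (k + 1)) (e : Fin 2 → Fin N)
    (r : Fin 2 → Fin k → Fin N) (σ : Fin N → Bool) :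
    intSum (insertEdgeEquiv N ν (e, r)) σ = spinProd e σ + intSum r σ := by
  simp only [intSum, Fin.sum_univ_succAbove _ ν, insertEdgeEquiv_apply, Fin.insertNth_apply_same,
    Fin.insertNth_apply_succAbove, spinProd]

theorem unnormCov_magSq_edge_nonneg {b : ℝ} (hb : 0 ≤ b) {k : ℕ} (r : Fin 2 → Fin k → Fin N)
    (e : Fin 2 → Fin N) :
    0 ≤ unnormCov (fun σ => Real.exp (b * intSum r σ)) (magSq N) (spinProd e) := by
  rw [unnormCov_comm, funext magSq_eq, unnormCov_const_mul_right, unnormCov_sum_right]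
  exact mul_nonneg (by positivity)
    (Finset.sum_nonneg fun a _ => griffiths_second hb (fun ν l => r l ν) e a)

/-- Inserting an edge decreases the covariance of `m²` with that edge at most by `exp (-2 b)`. -/
theorem edgeCov_insertEdge_ge {b : ℝ} (hb : 0 ≤ b) {k : ℕ} (ν : Fin (k + 1)) (e : Fin 2 → Fin N)
    (r : Fin 2 → Fin k → Fin N) :
    Real.exp (-(2 * b)) * (unnormCov (fun σ => Real.exp (b * intSum r σ)) (magSq N) (spinProd e) /
        Zpart b r ^ 2) ≤
      unnormCov (fun σ => Real.exp (b * intSum (insertEdgeEquiv N ν (e, r)) σ)) (magSq N)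
        (spinProd e) / Zpart b (insertEdgeEquiv N ν (e, r)) ^ 2 := by
  have hw : (fun σ => Real.exp (b * intSum (insertEdgeEquiv N ν (e, r)) σ)) =
      fun σ => Real.exp (b * spinProd e σ) * Real.exp (b * intSum r σ) := by
    funext σ
    rw [intSum_insertEdge, mul_add, Real.exp_add]
  have hZ : Zpart b (insertEdgeEquiv N ν (e, r)) ≤ Real.exp b * Zpart b r := by
    rw [Zpart, hw, Zpart, Finset.mul_sum]
    refine Finset.sum_le_sum fun σ _ => mul_le_mul_of_nonneg_right ?_ (Real.exp_pos _).le
    exact Real.exp_le_exp.2 (mul_le_of_le_one_right hb (spinProd_le_one e σ))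
  have hpos : 0 < Zpart b (insertEdgeEquiv N ν (e, r)) := total_pos fun _ => Real.exp_pos _
  have hpos' : 0 < Zpart b r := total_pos fun _ => Real.exp_pos _
  rw [hw, unnormCov_tilt _ _ _ (spinProd_sq e), Real.exp_neg, inv_mul_eq_div, div_div]
  refine div_le_div_of_nonneg_left (unnormCov_magSq_edge_nonneg hb r e) (by positivity) ?_
  calc _ ≤ (Real.exp b * Zpart b r) ^ 2 := pow_le_pow_left₀ hpos.le hZ 2
    _ = _ := by rw [mul_pow, ← Real.exp_nat_mul, mul_comm]; norm_cast

theorem sum_edgeCov_eq (b : ℝ) {k : ℕ} (r : Fin 2 → Fin k → Fin N) :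
    ((N : ℝ) ^ 2)⁻¹ * ∑ e : Fin 2 → Fin N,
      unnormCov (fun σ => Real.exp (b * intSum r σ)) (magSq N) (spinProd e) / Zpart b r ^ 2 =
      magSqVar b r := by
  rw [magSqVar, ← Finset.sum_div, ← unnormCov_sum_right, ← mul_div_assoc,
    ← unnormCov_const_mul_right, ← funext magSq_eq]

/-- The edge-averaged `β`-derivative of the thermal average of `m²` with `k + 1` edges controls
the edge-averaged variance of `m²` with `k` edges. -/
theorem avgMagSqVar_le_avgIdx_deriv {b : ℝ} (hb : 0 ≤ b) (N k : ℕ) :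
    ((k : ℝ) + 1) * (Real.exp (-(2 * b)) * avgMagSqVar N k b) ≤
      avgIdx N 2 (k + 1) fun im =>
        unnormCov (fun σ => Real.exp (b * intSum im σ)) (magSq N) (intSum im) /
          Zpart b im ^ 2 := by
  have h1 : ∀ im : Fin 2 → Fin (k + 1) → Fin N,
      unnormCov (fun σ => Real.exp (b * intSum im σ)) (magSq N) (intSum im) / Zpart b im ^ 2 =
      ∑ ν, unnormCov (fun σ => Real.exp (b * intSum im σ)) (magSq N)
        (spinProd fun l => im l ν) / Zpart b im ^ 2 := by
    intro im
    rw [← Finset.sum_div, ← unnormCov_sum_right]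
    rfl
  have h2 : ∀ (ν : Fin (k + 1)) (e : Fin 2 → Fin N) (r : Fin 2 → Fin k → Fin N),
      (fun l => insertEdgeEquiv N ν (e, r) l ν) = e := fun ν e r => by
    funext l
    rw [insertEdgeEquiv_apply, Fin.insertNth_apply_same]
  simp only [avgMagSqVar, avgIdx, h1]
  rw [Finset.sum_comm]
  calc _ = ((N : ℝ) ^ (2 * (k + 1)))⁻¹ * ∑ _ν : Fin (k + 1), ∑ e : Fin 2 → Fin N,
        ∑ r : Fin 2 → Fin k → Fin N, Real.exp (-(2 * b)) *
        (unnormCov (fun σ => Real.exp (b * intSum r σ)) (magSq N) (spinProd e) /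
          Zpart b r ^ 2) := by
        simp only [← sum_edgeCov_eq, Finset.sum_const, Finset.card_univ, Fintype.card_fin,
          nsmul_eq_mul, ← Finset.mul_sum]
        rw [Finset.sum_comm, mul_add, pow_add, mul_inv, mul_one]
        push_cast
        ring
    _ ≤ _ := by
        refine mul_le_mul_of_nonneg_left (Finset.sum_le_sum fun ν _ => ?_) (by positivity)
        rw [← (insertEdgeEquiv N ν).sum_comp, Fintype.sum_prod_type]
        refine Finset.sum_le_sum fun e _ => Finset.sum_le_sum fun r _ => ?_
        rw [h2]
        exact edgeCov_insertEdge_ge hb ν e r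

theorem avgIdx_const (hN : 0 < N) (p k : ℕ) (c : ℝ) : avgIdx N p k (fun _ => c) = c := by
  have : (N : ℝ) ≠ 0 := Nat.cast_ne_zero.2 hN.ne'
  rw [avgIdx, Finset.sum_const, Finset.card_univ]
  simp only [Fintype.card_pi, Fintype.card_fin, Finset.prod_const, Finset.card_univ, nsmul_eq_mul]
  rw [← pow_mul, mul_comm k p]
  push_cast
  rw [← mul_assoc, inv_mul_cancel₀ (pow_ne_zero _ this), one_mul]

theorem avgIdx_mono {p k : ℕ} {f g : (Fin p → Fin k → Fin N) → ℝ} (h : ∀ im, f im ≤ g im) :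
    avgIdx N p k f ≤ avgIdx N p k g :=
  mul_le_mul_of_nonneg_left (Finset.sum_le_sum fun im _ => h im) (by positivity)

theorem avgIdx_sub {p k : ℕ} (f g : (Fin p → Fin k → Fin N) → ℝ) :
    avgIdx N p k (fun im => f im - g im) = avgIdx N p k f - avgIdx N p k g := by
  simp only [avgIdx, Finset.sum_sub_distrib, mul_sub]

theorem avgIdx_add {p k : ℕ} (f g : (Fin p → Fin k → Fin N) → ℝ) :
    avgIdx N p k (fun im => f im + g im) = avgIdx N p k f + avgIdx N p k g := by
  simp only [avgIdx, Finset.sum_add_distrib, mul_add]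

theorem avgIdx_const_mul {p k : ℕ} (c : ℝ) (f : (Fin p → Fin k → Fin N) → ℝ) :
    avgIdx N p k (fun im => c * f im) = c * avgIdx N p k f := by
  simp only [avgIdx, ← Finset.mul_sum]
  ring

theorem abs_avgIdx_sub_le {p k : ℕ} {f g h : (Fin p → Fin k → Fin N) → ℝ}
    (hfg : ∀ im, |f im - g im| ≤ h im) :
    |avgIdx N p k f - avgIdx N p k g| ≤ avgIdx N p k h := by
  rw [← avgIdx_sub, avgIdx, abs_mul, abs_of_nonneg (by positivity)]
  exact mul_le_mul_of_nonneg_left ((Finset.abs_sum_le_sum_abs _ _).trans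
    (Finset.sum_le_sum fun im _ => hfg im)) (by positivity)

theorem avgIdx_mem_Icc (hN : 0 < N) {p k : ℕ} {f : (Fin p → Fin k → Fin N) → ℝ}
    (h : ∀ im, f im ∈ Set.Icc (0 : ℝ) 1) : avgIdx N p k f ∈ Set.Icc (0 : ℝ) 1 :=
  ⟨(avgIdx_const hN p k 0).symm.le.trans (avgIdx_mono fun im => (h im).1),
    (avgIdx_mono fun im => (h im).2).trans (avgIdx_const hN p k 1).le⟩

theorem continuous_avgMagSqVar (N k : ℕ) : Continuous (avgMagSqVar N k) := by
  refine continuous_const.mul (continuous_finsetSum _ fun im _ => ?_)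
  exact continuous_unnormCov_exp_div (magSq N) (magSq N) (intSum im)

/-- Monotonicity of `⟨m²⟩` in `β` forces its variance to be small on `β`-average. -/
theorem integral_avgMagSqVar_le (hN : 0 < N) (k : ℕ) {β₁ β₂ : ℝ} (h₁ : 0 ≤ β₁) (h₁₂ : β₁ ≤ β₂) :
    ∫ b in β₁..β₂, avgMagSqVar N k b ≤ Real.exp (2 * β₂) / ((k : ℝ) + 1) := by
  set D : ℝ → ℝ := fun b => avgIdx N 2 (k + 1) fun im =>
    unnormCov (fun σ => Real.exp (b * intSum im σ)) (magSq N) (intSum im) / Zpart b im ^ 2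
  set F : ℝ → ℝ := fun b => avgIdx N 2 (k + 1) fun im =>
    gibbsAvg (fun σ => Real.exp (b * intSum im σ)) (magSq N)
  have hderiv : ∀ b, HasDerivAt F (D b) b := fun b =>
    (HasDerivAt.fun_sum fun im _ => hasDerivAt_gibbsAvg (magSq N) (intSum im) b).const_mul _
  have hDc : Continuous D := by
    refine continuous_const.mul (continuous_finsetSum _ fun im _ => ?_)
    exact continuous_unnormCov_exp_div (magSq N) (intSum im) (intSum im)
  have hF01 : ∀ b, F b ∈ Set.Icc (0 : ℝ) 1 := fun b =>
    avgIdx_mem_Icc hN fun im => gibbsAvg_mem_Icc (fun _ => Real.exp_pos _) magSq_mem_Icc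
  have hint : ∫ b in β₁..β₂, D b = F β₂ - F β₁ :=
    intervalIntegral.integral_eq_sub_of_hasDerivAt (fun b _ => hderiv b)
      (hDc.intervalIntegrable _ _)
  have hle : ∫ b in β₁..β₂, avgMagSqVar N k b ≤
      ∫ b in β₁..β₂, Real.exp (2 * β₂) / ((k : ℝ) + 1) * D b := by
    refine intervalIntegral.integral_mono_on h₁₂
      ((continuous_avgMagSqVar N k).intervalIntegrable _ _)
      ((continuous_const.mul hDc).intervalIntegrable _ _) fun b hb => ?_
    have h := avgMagSqVar_le_avgIdx_deriv (h₁.trans hb.1) N k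
    have hV : 0 ≤ avgMagSqVar N k b := (avgIdx_mem_Icc hN fun im => magSqVar_mem_Icc b im).1
    have hexp : 1 ≤ Real.exp (2 * β₂) * Real.exp (-(2 * b)) := by
      rw [← Real.exp_add, Real.one_le_exp_iff]
      linarith [hb.2]
    rw [div_mul_eq_mul_div, le_div_iff₀ (by positivity)]
    calc _ ≤ (Real.exp (2 * β₂) * Real.exp (-(2 * b))) * (avgMagSqVar N k b * ((k : ℝ) + 1)) :=
          le_mul_of_one_le_left (by positivity) hexp
      _ = Real.exp (2 * β₂) * (((k : ℝ) + 1) * (Real.exp (-(2 * b)) * avgMagSqVar N k b)) := by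
          ring
      _ ≤ _ := mul_le_mul_of_nonneg_left h (Real.exp_pos _).le
  refine hle.trans ?_
  rw [intervalIntegral.integral_const_mul, hint]
  refine mul_le_of_le_one_right (by positivity) ?_
  linarith [(hF01 β₂).2, (hF01 β₁).1]

end DilutedModel

section Poisson

theorem pois_nonneg {lam : ℝ} (h : 0 ≤ lam) (k : ℕ) : 0 ≤ pois lam k := by
  unfold pois
  positivity

theorem hasSum_pois_mul_exp (lam c : ℝ) :
    HasSum (fun k : ℕ => pois lam k * Real.exp (c * k))
      (Real.exp (-lam) * Real.exp (lam * Real.exp c)) := by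
  have h : HasSum (fun k : ℕ => (lam * Real.exp c) ^ k / (k.factorial : ℝ))
      (Real.exp (lam * Real.exp c)) := by
    rw [Real.exp_eq_exp_ℝ]
    exact NormedSpace.expSeries_div_hasSum_exp _
  refine (h.mul_left (Real.exp (-lam))).congr_fun fun k => ?_
  rw [pois, mul_comm c, Real.exp_nat_mul, mul_pow]
  ring

theorem hasSum_pois (lam : ℝ) : HasSum (pois lam) 1 := by
  simpa [← Real.exp_add] using hasSum_pois_mul_exp lam 0

theorem hasSum_pois_div_add_one_le {lam : ℝ} (h : 0 < lam) :
    (Summable fun k : ℕ => pois lam k / ((k : ℝ) + 1)) ∧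
      ∑' k : ℕ, pois lam k / ((k : ℝ) + 1) ≤ lam⁻¹ := by
  have h1 : ∀ k : ℕ, pois lam k / ((k : ℝ) + 1) = lam⁻¹ * pois lam (k + 1) := fun k => by
    simp only [pois, Nat.factorial_succ]
    push_cast
    field_simp
    ring
  have hs := (summable_nat_add_iff 1).2 (hasSum_pois lam).summable
  have h2 := (hasSum_pois lam).summable.tsum_eq_zero_add
  rw [(hasSum_pois lam).tsum_eq] at h2
  simp only [h1]
  refine ⟨hs.mul_left _, ?_⟩
  rw [tsum_mul_left]
  refine mul_le_of_le_one_right (by positivity) ?_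
  linarith [pois_nonneg h.le 0]

theorem abs_tsum_mul_sub_tsum_mul_le {P x y c : ℕ → ℝ} (hP : ∀ k, 0 ≤ P k)
    (hy : Summable fun k => P k * y k) (hc : Summable fun k => P k * c k)
    (h : ∀ k, |x k - y k| ≤ c k) :
    |∑' k, P k * x k - ∑' k, P k * y k| ≤ ∑' k, P k * c k := by
  have hle : ∀ k, ‖P k * (x k - y k)‖ ≤ P k * c k := fun k => by
    rw [Real.norm_eq_abs, abs_mul, abs_of_nonneg (hP k)]
    exact mul_le_mul_of_nonneg_left (h k) (hP k)
  have hd : Summable fun k => P k * (x k - y k) := hc.of_norm_bounded hle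
  have hx : Summable fun k => P k * x k := by
    refine (hd.add hy).congr fun k => ?_
    ring
  rw [← hx.tsum_sub hy]
  simp only [← mul_sub]
  exact tsum_of_norm_bounded hc.hasSum hle

theorem summable_pois_mul {lam : ℝ} (h : 0 ≤ lam) {y : ℕ → ℝ}
    (hy : ∀ k, y k ∈ Set.Icc (0 : ℝ) 1) : Summable fun k => pois lam k * y k :=
  (hasSum_pois lam).summable.of_nonneg_of_le (fun k => mul_nonneg (pois_nonneg h k) (hy k).1)
    fun k => mul_le_of_le_one_right (pois_nonneg h k) (hy k).2

end Poisson

section CavityPerturbation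

variable {N : ℕ} {α t : ℝ}

theorem abs_qPowAvgPert_sub_qPowAvg_le (hN : 0 < N) (hα : 0 ≤ α) (ht : 0 ≤ t) {b B ε : ℝ}
    (hb : 0 ≤ b) (hbB : b ≤ B) (hε : 0 < ε) :
    |qPowAvgPert N 2 α b t 1 2 - qPowAvg N 2 α b 1 2| ≤
      (∑' k : ℕ, pois (2 * α * t) k * Real.exp (2 * B * k)) *
        (ε + ε⁻¹ * ∑' k, pois (α * N) k * avgMagSqVar N k b) := by
  set M := ∑' k : ℕ, pois (2 * α * t) k * Real.exp (2 * B * k)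
  have hlam : 0 ≤ 2 * α * t := by positivity
  have hlam' : 0 ≤ α * N := by positivity
  have hsV : Summable fun k => pois (α * N) k * avgMagSqVar N k b :=
    summable_pois_mul hlam' fun k => avgIdx_mem_Icc hN fun im => magSqVar_mem_Icc b im
  have hsum : HasSum (fun k => pois (α * N) k * (M * (ε + ε⁻¹ * avgMagSqVar N k b)))
      (M * (ε + ε⁻¹ * ∑' k, pois (α * N) k * avgMagSqVar N k b)) := by
    have := (((hasSum_pois (α * N)).mul_right ε).add (hsV.hasSum.mul_left ε⁻¹)).mul_left M
    rw [one_mul] at this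
    exact this.congr_fun fun k => by ring
  rw [← hsum.tsum_eq]
  refine abs_tsum_mul_sub_tsum_mul_le (pois_nonneg hlam') ?_ hsum.summable fun k => ?_
  · refine summable_pois_mul hlam' fun k => avgIdx_mem_Icc hN fun im => ?_
    beta_reduce
    rw [OmegaB_eq_gibbsAvg]
    exact gibbsAvg_mem_Icc (fun _ => Real.exp_pos _) magSq_mem_Icc
  have hK : avgIdx N 2 k (fun im => M * (ε + ε⁻¹ * magSqVar b im)) =
      M * (ε + ε⁻¹ * avgMagSqVar N k b) := by
    rw [avgIdx_const_mul, avgIdx_add, avgIdx_const hN, avgIdx_const_mul, avgMagSqVar]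
  rw [← hK]
  refine abs_avgIdx_sub_le fun im => ?_
  set a := OmegaB b im 1 fun σs => qOv N 1 σs ^ 2
  set v := ε + ε⁻¹ * magSqVar b im
  have hv0 : 0 ≤ v := by
    have := (magSqVar_mem_Icc b im).1
    positivity
  have hsa : HasSum (fun k' => pois (2 * α * t) k' * a) a := by
    simpa using (hasSum_pois (2 * α * t)).mul_right a
  have hsM : HasSum (fun k' : ℕ => pois (2 * α * t) k' * (Real.exp (2 * B * k') * v)) (M * v) :=
    ((hasSum_pois_mul_exp (2 * α * t) (2 * B)).summable.hasSum.mul_right v).congr_fun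
      fun k' => by ring
  change |_ - a| ≤ _
  rw [← hsM.tsum_eq]
  nth_rewrite 1 [← hsa.tsum_eq]
  refine abs_tsum_mul_sub_tsum_mul_le (pois_nonneg hlam) hsa.summable hsM.summable fun k' => ?_
  rw [← avgIdx_const hN (2 - 1) k' a, ← avgIdx_const hN (2 - 1) k' (Real.exp _ * v)]
  refine abs_avgIdx_sub_le fun im' => (abs_OmegaPert_sub_OmegaB_le hb hε im im').trans ?_
  refine mul_le_mul_of_nonneg_right (Real.exp_le_exp.2 ?_) hv0
  gcongr

theorem integral_tsum_avgMagSqVar_le (hN : 0 < N) (hα : 0 < α) {β₁ β₂ : ℝ} (h₁ : 0 ≤ β₁)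
    (h₁₂ : β₁ ≤ β₂) :
    ∫ b in β₁..β₂, ∑' k, pois (α * N) k * avgMagSqVar N k b ≤
      Real.exp (2 * β₂) / (α * N) := by
  have hlam : 0 < α * N := mul_pos hα (Nat.cast_pos.2 hN)
  have hV : ∀ k b, avgMagSqVar N k b ∈ Set.Icc (0 : ℝ) 1 := fun k b =>
    avgIdx_mem_Icc hN fun im => magSqVar_mem_Icc b im
  have hswap : HasSum (fun k => ∫ b in β₁..β₂, pois (α * N) k * avgMagSqVar N k b)
      (∫ b in β₁..β₂, ∑' k, pois (α * N) k * avgMagSqVar N k b) := by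
    refine intervalIntegral.hasSum_integral_of_dominated_convergence (fun k _ => pois (α * N) k)
      (fun k => ((continuous_avgMagSqVar N k).const_mul _).aestronglyMeasurable)
      (fun k => Eventually.of_forall fun b _ => ?_)
      (Eventually.of_forall fun b _ => (hasSum_pois _).summable)
      intervalIntegrable_const
      (Eventually.of_forall fun b _ => (summable_pois_mul hlam.le fun k => hV k b).hasSum)
    rw [Real.norm_of_nonneg (mul_nonneg (pois_nonneg hlam.le k) (hV k b).1)]
    exact mul_le_of_le_one_right (pois_nonneg hlam.le k) (hV k b).2
  obtain ⟨hs, hle⟩ := hasSum_pois_div_add_one_le hlam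
  rw [← hswap.tsum_eq]
  calc _ ≤ ∑' k : ℕ, Real.exp (2 * β₂) * (pois (α * N) k / ((k : ℝ) + 1)) := by
        refine hswap.summable.tsum_le_tsum (fun k => ?_) (hs.mul_left _)
        rw [intervalIntegral.integral_const_mul, mul_div_left_comm]
        exact mul_le_mul_of_nonneg_left (integral_avgMagSqVar_le hN k h₁ h₁₂)
          (pois_nonneg hlam.le k)
    _ ≤ _ := by
        rw [tsum_mul_left, div_eq_mul_inv]
        exact mul_le_mul_of_nonneg_left hle (Real.exp_pos _).le

theorem abs_integral_qPowAvgPert_sub_le (hN : 0 < N) (hα : 0 < α) (ht : 0 ≤ t) {β₁ β₂ ε : ℝ}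
    (h₁ : 0 ≤ β₁) (h₁₂ : β₁ ≤ β₂) (hε : 0 < ε) :
    |∫ b in β₁..β₂, (qPowAvgPert N 2 α b t 1 2 - qPowAvg N 2 α b 1 2)| ≤
      (∑' k : ℕ, pois (2 * α * t) k * Real.exp (2 * β₂ * k)) *
        ((β₂ - β₁) * ε + ε⁻¹ * (Real.exp (2 * β₂) / (α * N))) := by
  have hlam : 0 ≤ α * N := by positivity
  have hV : ∀ k b, avgMagSqVar N k b ∈ Set.Icc (0 : ℝ) 1 := fun k b =>
    avgIdx_mem_Icc hN fun im => magSqVar_mem_Icc b im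
  have hc : Continuous fun b => ∑' k, pois (α * N) k * avgMagSqVar N k b := by
    refine continuous_tsum (fun k => (continuous_avgMagSqVar N k).const_mul _)
      (hasSum_pois (α * N)).summable fun k b => ?_
    rw [Real.norm_of_nonneg (mul_nonneg (pois_nonneg hlam k) (hV k b).1)]
    exact mul_le_of_le_one_right (pois_nonneg hlam k) (hV k b).2
  refine (intervalIntegral.norm_integral_le_of_norm_le h₁₂
    (f := fun b => qPowAvgPert N 2 α b t 1 2 - qPowAvg N 2 α b 1 2)
    (g := fun b => (∑' k : ℕ, pois (2 * α * t) k * Real.exp (2 * β₂ * k)) *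
      (ε + ε⁻¹ * ∑' k, pois (α * N) k * avgMagSqVar N k b)) (Eventually.of_forall fun b hb =>
      abs_qPowAvgPert_sub_qPowAvg_le hN hα.le ht (h₁.trans hb.1.le) hb.2 hε)
    (Continuous.intervalIntegrable (by fun_prop) _ _)).trans ?_
  rw [intervalIntegral.integral_const_mul, intervalIntegral.integral_add
    intervalIntegrable_const ((hc.const_mul _).intervalIntegrable _ _),
    intervalIntegral.integral_const, intervalIntegral.integral_const_mul, smul_eq_mul]
  refine mul_le_mul_of_nonneg_left ?_ (tsum_nonneg fun k =>
    mul_nonneg (pois_nonneg (by positivity) k) (Real.exp_pos _).le)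
  gcongr
  exact integral_tsum_avgMagSqVar_le hN hα h₁ h₁₂

end CavityPerturbation


/-- Stochastic stability of the filled monomial `m²` in the diluted Curie–Weiss model
(`p = 2`, `γ = α`): for every `t ∈ [0,1]` and `0 < β₁ < β₂`,
`∫_{β₁}^{β₂} (⟨m²⟩_{N,t}(β) - ⟨m²⟩_N(β)) dβ → 0` as `N → ∞`,
where `m = (1/N)∑_i σ_i` is the magnetization (the one-replica overlap). -/
theorem filled_monomial_t_independence (α : ℝ) (hα : 0 < α) (t : ℝ)
    (ht : t ∈ Set.Icc (0 : ℝ) 1) (β₁ β₂ : ℝ) (hβ₁ : 0 < β₁) (hβ : β₁ < β₂) :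
    Tendsto (fun N : ℕ =>
        ∫ b in β₁..β₂, (qPowAvgPert N 2 α b t 1 2 - qPowAvg N 2 α b 1 2))
      atTop (nhds 0) := by
  set M := ∑' k : ℕ, pois (2 * α * t) k * Real.exp (2 * β₂ * k)
  have hlim : Tendsto (fun N : ℕ => M * ((β₂ - β₁) + Real.exp (2 * β₂) / α) * (√(N : ℝ))⁻¹)
      atTop (nhds 0) := by
    have h : Tendsto (fun N : ℕ => (√(N : ℝ))⁻¹) atTop (nhds 0) :=
      tendsto_inv_atTop_zero.comp (Real.tendsto_sqrt_atTop.comp tendsto_natCast_atTop_atTop)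
    simpa using h.const_mul (M * ((β₂ - β₁) + Real.exp (2 * β₂) / α))
  refine squeeze_zero_norm' ?_ hlim
  filter_upwards [eventually_gt_atTop 0] with N hN
  have hN' : (0 : ℝ) < N := Nat.cast_pos.2 hN
  have hs : 0 < √(N : ℝ) := Real.sqrt_pos.2 hN'
  refine (abs_integral_qPowAvgPert_sub_le hN hα ht.1 hβ₁.le hβ.le (inv_pos.2 hs)).trans_eq ?_
  have hsq : √(N : ℝ) / N = (√(N : ℝ))⁻¹ := Real.sqrt_div_self
  rw [mul_assoc M, inv_inv, add_mul, ← hsq]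
  congr 2
  field_simp
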